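/- Let τ ∈ (0,1), ν > -1/2 and N ≥ 1 be an integer. Define f_N(z,w) := −∑_{k=0}^{N-1}∑_{j=0}^{k} ((2k)!!·(2j−1)!!·τ^{2k+2j+1}/(2^{k+j}·Γ(k+ν+3/2)·Γ(j+ν+1)))·L_{2k+1}^{(2ν)}(2z/τ)·L_{2j}^{(2ν)}(2w/τ). Then for all z,w ∈ ℂ: ((1−τ²)/2)·z·∂_z²f_N(z,w) + ( (2ν+1)(1−τ²)/2 + 2τz )·∂_zf_N(z,w) + ( τ(2ν+1) − 2z )·f_N(z,w) = (2^{2ν+1}/√π)·∑_{k=0}^{N-1} ((2k)!·τ^{4k}/Γ(2k+2ν+1))·L_{2k}^{(2ν)}(2z/τ)·L_{2k}^{(2ν)}(2w/τ) − ((2N)!!·τ^{2N}/(2^{N−1}·Γ(N+ν+1/2)))·L_{2N}^{(2ν)}(2z/τ)·∑_{j=0}^{N-1} ((2j−1)!!·τ^{2j}/(2^j·Γ(j+ν+1)))·L_{2j}^{(2ν)}(2w/τ). -/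

import Mathlib

open MeasureTheory

/-- Generalized Laguerre polynomial `L_j^{(ν)}(z)`. -/
noncomputable def laguerre (ν : ℝ) (j : ℕ) (z : ℂ) : ℂ :=
  ∑ k ∈ Finset.range (j + 1),
    ((Real.Gamma ((j : ℝ) + ν + 1) /
        (((j - k).factorial : ℝ) * Real.Gamma (ν + (k : ℝ) + 1)) : ℝ) : ℂ) *
      (-z) ^ k / ((k.factorial : ℝ) : ℂ)

/-- `f_N(z,w)` of the proof of Theorem 1.1 (ii). -/
noncomputable def fN (τ ν : ℝ) (N : ℕ) (z w : ℂ) : ℂ :=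
  -∑ k ∈ Finset.range N, ∑ j ∈ Finset.range (k + 1),
    ((((2 : ℝ) ^ k * (k.factorial : ℝ)) *
          (((2 * j).factorial : ℝ) / ((2 : ℝ) ^ j * (j.factorial : ℝ))) *
          τ ^ (2 * k + 2 * j + 1) /
        ((2 : ℝ) ^ (k + j) * Real.Gamma ((k : ℝ) + ν + 3 / 2) *
          Real.Gamma ((j : ℝ) + ν + 1)) : ℝ) : ℂ) *
      laguerre (2 * ν) (2 * k + 1) (2 * z / (τ : ℂ)) *
      laguerre (2 * ν) (2 * j) (2 * w / (τ : ℂ))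

open Polynomial in
/-- The generalized Laguerre polynomial as an element of `ℂ[X]`. -/
noncomputable def laguerrePoly (α : ℝ) (n : ℕ) : ℂ[X] :=
  ∑ k ∈ Finset.range (n + 1),
    C ((Real.Gamma ((n : ℝ) + α + 1) * (n.choose k : ℝ) /
      ((n.factorial : ℝ) * Real.Gamma (α + (k : ℝ) + 1)) * (-1) ^ k : ℝ) : ℂ) * X ^ k

/-- The factor of `fN` carrying the outer summation index. -/
noncomputable def outerCoeff (τ ν : ℝ) (k : ℕ) : ℝ :=
  (2 : ℝ) ^ k * (k.factorial : ℝ) * τ ^ (2 * k + 1) /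
    ((2 : ℝ) ^ k * Real.Gamma ((k : ℝ) + ν + 3 / 2))

/-- The factor of `fN` carrying the inner summation index. -/
noncomputable def innerCoeff (τ ν : ℝ) (j : ℕ) : ℝ :=
  (((2 * j).factorial : ℝ) / ((2 : ℝ) ^ j * (j.factorial : ℝ))) * τ ^ (2 * j) /
    ((2 : ℝ) ^ j * Real.Gamma ((j : ℝ) + ν + 1))

/-- The coefficient of the boundary term of the differential equation. -/
noncomputable def boundaryCoeff (τ ν : ℝ) (k : ℕ) : ℝ :=
  2 * ((2 : ℝ) ^ k * (k.factorial : ℝ)) * τ ^ (2 * k) /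
    ((2 : ℝ) ^ k * Real.Gamma ((k : ℝ) + ν + 1 / 2))

section Laguerre

open Polynomial

theorem eval_laguerrePoly (α : ℝ) (n : ℕ) (x : ℂ) :
    (laguerrePoly α n).eval x = laguerre α n x := by
  unfold laguerrePoly laguerre
  rw [eval_finsetSum]
  refine Finset.sum_congr rfl fun k hk => ?_
  have hk' : k ≤ n := Nat.lt_succ_iff.mp (Finset.mem_range.mp hk)
  rw [Nat.cast_choose ℝ hk', eval_mul, eval_C, eval_pow, eval_X, neg_pow x k]
  push_cast
  have h1 : (n.factorial : ℂ) ≠ 0 := mod_cast n.factorial_ne_zero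
  field_simp

theorem coeff_laguerrePoly (α : ℝ) (n k : ℕ) :
    (laguerrePoly α n).coeff k =
      ((Real.Gamma ((n : ℝ) + α + 1) * (n.choose k : ℝ) /
        ((n.factorial : ℝ) * Real.Gamma (α + (k : ℝ) + 1)) * (-1) ^ k : ℝ) : ℂ) := by
  unfold laguerrePoly
  rw [finsetSum_coeff]
  simp only [coeff_C_mul_X_pow]
  rw [Finset.sum_ite_eq]
  split_ifs with h
  · rfl
  · rw [Nat.choose_eq_zero_of_lt (by simpa using h)]
    simp

theorem Gamma_add_nat_ne_zero {α : ℝ} (hα : -1 < α) (k : ℕ) :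
    Real.Gamma (α + (k : ℝ) + 1) ≠ 0 :=
  (Real.Gamma_pos_of_pos (by have := k.cast_nonneg (α := ℝ); linarith)).ne'

theorem Gamma_add_nat_succ {α : ℝ} (hα : -1 < α) (k : ℕ) :
    Real.Gamma (α + ((k + 1 : ℕ) : ℝ) + 1) = (α + k + 1) * Real.Gamma (α + (k : ℝ) + 1) := by
  rw [← Real.Gamma_add_one (by have := k.cast_nonneg (α := ℝ); linarith)]
  push_cast
  congr 1
  ring

theorem cast_choose_succ_right_mul (n k : ℕ) :
    (n.choose (k + 1) : ℝ) * (k + 1) = n.choose k * (n - k) := by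
  rcases le_or_gt k n with h | h
  · have := Nat.choose_succ_right_eq n k
    rw [← Nat.cast_sub h]
    exact_mod_cast this
  · rw [Nat.choose_eq_zero_of_lt h, Nat.choose_eq_zero_of_lt (by omega)]
    simp

theorem laguerrePoly_ode {α : ℝ} (hα : -1 < α) (n : ℕ) :
    X * derivative (derivative (laguerrePoly α n)) +
      (C ((α : ℂ) + 1) - X) * derivative (laguerrePoly α n) +
        C (n : ℂ) * laguerrePoly α n = 0 := by
  have key (k : ℕ) : ((k : ℂ) + 1) * (k + 1 + α) * (laguerrePoly α n).coeff (k + 1) =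
      -((n - k) * (laguerrePoly α n).coeff k) := by
    rw [coeff_laguerrePoly, coeff_laguerrePoly, Gamma_add_nat_succ hα]
    norm_cast
    have h1 := Gamma_add_nat_ne_zero hα k
    have h2 : α + k + 1 ≠ 0 := by have := k.cast_nonneg (α := ℝ); linarith
    have h3 : (n.factorial : ℝ) ≠ 0 := mod_cast n.factorial_ne_zero
    have h4 := cast_choose_succ_right_mul n k
    push_cast
    rw [pow_succ]
    field_simp
    linear_combination (-Real.Gamma (n + α + 1) * (k + 1 + α)) * h4
  ext k
  rw [sub_mul]
  cases k with
  | zero =>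
    have := key 0
    simp [coeff_derivative, mul_coeff_zero] at this ⊢
    linear_combination this
  | succ k =>
    have := key (k + 1)
    simp only [coeff_add, coeff_sub, coeff_X_mul, coeff_C_mul, coeff_derivative, coeff_zero]
    push_cast at this ⊢
    linear_combination this

theorem X_mul_derivative_laguerrePoly {α : ℝ} (hα : -1 < α) (n : ℕ) :
    X * derivative (laguerrePoly α (n + 1)) =
      C ((n : ℂ) + 1) * laguerrePoly α (n + 1) - C ((n : ℂ) + 1 + α) * laguerrePoly α n := by
  have key (k : ℕ) : (k : ℂ) * (laguerrePoly α (n + 1)).coeff k =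
      (n + 1) * (laguerrePoly α (n + 1)).coeff k - (n + 1 + α) * (laguerrePoly α n).coeff k := by
    rw [coeff_laguerrePoly, coeff_laguerrePoly, show ((n + 1 : ℕ) : ℝ) + α + 1 =
      α + (n + 1 : ℕ) + 1 by ring, Gamma_add_nat_succ hα, show (n : ℝ) + α + 1 = α + n + 1 by ring,
      Nat.factorial_succ]
    norm_cast
    have h1 := Gamma_add_nat_ne_zero hα k
    have h3 : (n.factorial : ℝ) ≠ 0 := mod_cast n.factorial_ne_zero
    have h4 : ((n + 1).choose k : ℝ) * (n + 1 - k) = (n + 1) * n.choose k := by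
      cases k with
      | zero => simp
      | succ k =>
        have h5 := cast_choose_succ_right_mul n k
        rw [Nat.choose_succ_succ]
        push_cast
        linear_combination -h5
    have h6 : (n : ℝ) + 1 ≠ 0 := by positivity
    push_cast
    field_simp
    linear_combination -(n + 1 + α) * Real.Gamma (α + n + 1) * h4
  ext k
  have := key k
  cases k with
  | zero =>
    simp [mul_coeff_zero] at this ⊢
    linear_combination this
  | succ k =>
    simp only [coeff_sub, coeff_X_mul, coeff_C_mul, coeff_derivative]
    push_cast at this ⊢
    linear_combination this

theorem laguerrePoly_succ {α : ℝ} (hα : -1 < α) (n : ℕ) :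
    C ((n : ℂ) + 1) * laguerrePoly α (n + 1) =
      X * derivative (laguerrePoly α n) + (C ((n : ℂ) + α + 1) - X) * laguerrePoly α n := by
  have hG : Real.Gamma (((n + 1 : ℕ) : ℝ) + α + 1) =
      (α + n + 1) * Real.Gamma ((n : ℝ) + α + 1) := by
    rw [show ((n + 1 : ℕ) : ℝ) + α + 1 = α + (n + 1 : ℕ) + 1 by ring, Gamma_add_nat_succ hα,
      show (n : ℝ) + α + 1 = α + n + 1 by ring]
  have h3 : (n.factorial : ℝ) ≠ 0 := mod_cast n.factorial_ne_zero
  have h6 : (n : ℝ) + 1 ≠ 0 := by positivity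
  ext k
  rw [sub_mul]
  cases k with
  | zero =>
    have h1 := Gamma_add_nat_ne_zero hα 0
    have : ((n : ℂ) + 1) * (laguerrePoly α (n + 1)).coeff 0 =
        (n + α + 1) * (laguerrePoly α n).coeff 0 := by
      rw [coeff_laguerrePoly, coeff_laguerrePoly, hG, Nat.factorial_succ]
      norm_cast
      push_cast at h1 ⊢
      simp only [Nat.choose_zero_right]
      field_simp
      ring
    simp [mul_coeff_zero] at this ⊢
    linear_combination this
  | succ k =>
    have h1 := Gamma_add_nat_ne_zero hα k
    have h2 : α + k + 1 ≠ 0 := by have := k.cast_nonneg (α := ℝ); linarith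
    have h4 := cast_choose_succ_right_mul n k
    have : ((n : ℂ) + 1) * (laguerrePoly α (n + 1)).coeff (k + 1) =
        (k + 1 + (n + α + 1)) * (laguerrePoly α n).coeff (k + 1) - (laguerrePoly α n).coeff k := by
      simp only [coeff_laguerrePoly]
      rw [hG, Nat.factorial_succ, Gamma_add_nat_succ hα, Nat.choose_succ_succ, pow_succ]
      norm_cast
      push_cast
      field_simp
      linear_combination Real.Gamma (n + α + 1) * h4
    simp only [coeff_add, coeff_sub, coeff_X_mul, coeff_C_mul, coeff_derivative]
    linear_combination this

/-- The rescaled Laguerre polynomial `z ↦ L_n^{(α)}(2z/τ)`. -/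
noncomputable def scaledLaguerre (τ α : ℝ) (n : ℕ) : ℂ[X] :=
  (laguerrePoly α n).comp (C (2 / (τ : ℂ)) * X)

theorem eval_scaledLaguerre (τ α : ℝ) (n : ℕ) (z : ℂ) :
    (scaledLaguerre τ α n).eval z = laguerre α n (2 * z / (τ : ℂ)) := by
  rw [scaledLaguerre, eval_comp, ← eval_laguerrePoly]
  simp only [eval_mul, eval_C, eval_X]
  congr 1
  ring

/-- The differential operator acting on the first variable of `fN`, applied to `p` and evaluated at `z`. -/
noncomputable def diffOp (τ ν : ℝ) (p : ℂ[X]) (z : ℂ) : ℂ :=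
  ((1 - (τ : ℂ) ^ 2) / 2) * z * (derivative (derivative p)).eval z
    + ((2 * (ν : ℂ) + 1) * (1 - (τ : ℂ) ^ 2) / 2 + 2 * (τ : ℂ) * z) * (derivative p).eval z
    + ((τ : ℂ) * (2 * (ν : ℂ) + 1) - 2 * z) * p.eval z

theorem diffOp_sub_C_mul (τ ν : ℝ) (p q : ℂ[X]) (c z : ℂ) :
    diffOp τ ν (p - C c * q) z = diffOp τ ν p z - c * diffOp τ ν q z := by
  simp only [diffOp, derivative_sub, derivative_C_mul, eval_sub, eval_mul, eval_C]
  ring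

theorem diffOp_scaledLaguerre {τ ν : ℝ} (hτ : τ ≠ 0) (hν : -(1 / 2) < ν) (n : ℕ) (z : ℂ) :
    diffOp τ ν (scaledLaguerre τ (2 * ν) (n + 1)) z =
      (τ : ℂ) * (n + 2) * (scaledLaguerre τ (2 * ν) (n + 2)).eval z
        - (n + 1 + 2 * ν) / τ * (scaledLaguerre τ (2 * ν) n).eval z := by
  have hα : -1 < 2 * ν := by linarith
  have hτ' : (τ : ℂ) ≠ 0 := mod_cast hτ
  obtain ⟨x, rfl⟩ : ∃ x : ℂ, z = τ * x / 2 := ⟨2 * z / τ, by field_simp⟩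
  have hx : 2 / (τ : ℂ) * (τ * x / 2) = x := by field_simp
  have e1 := congrArg (eval x) (laguerrePoly_ode hα (n + 1))
  have e2 := congrArg (eval x) (X_mul_derivative_laguerrePoly hα n)
  have e3 := congrArg (eval x) (laguerrePoly_succ hα (n + 1))
  simp only [eval_add, eval_sub, eval_mul, eval_C, eval_X, eval_zero] at e1 e2 e3
  simp only [diffOp, scaledLaguerre, derivative_comp, derivative_mul, derivative_C, derivative_X,
    eval_mul, eval_comp, eval_C, eval_X, hx, zero_mul, zero_add, mul_one]
  push_cast at e1 e2 e3
  field_simp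
  linear_combination (1 - (τ : ℂ) ^ 2) * e1 + e2 - (τ : ℂ) ^ 2 * e3

end Laguerre

open Polynomial in
/-- `fN` as a polynomial in its first variable. -/
noncomputable def fNPoly (τ ν : ℝ) (N : ℕ) (w : ℂ) : ℂ[X] :=
  -∑ k ∈ Finset.range N, C ((outerCoeff τ ν k : ℂ) *
    ∑ j ∈ Finset.range (k + 1), (innerCoeff τ ν j : ℂ) *
      laguerre (2 * ν) (2 * j) (2 * w / (τ : ℂ))) * scaledLaguerre τ (2 * ν) (2 * k + 1)

theorem eval_fNPoly (τ ν : ℝ) (N : ℕ) (z w : ℂ) :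
    (fNPoly τ ν N w).eval z = fN τ ν N z w := by
  simp only [fNPoly, fN, Polynomial.eval_neg, Polynomial.eval_finsetSum, Polynomial.eval_mul,
    Polynomial.eval_C, eval_scaledLaguerre, Finset.mul_sum, Finset.sum_mul]
  congr 1
  refine Finset.sum_congr rfl fun k _ => Finset.sum_congr rfl fun j _ => ?_
  have h : (2 : ℝ) ^ k * (k.factorial : ℝ) *
        (((2 * j).factorial : ℝ) / ((2 : ℝ) ^ j * (j.factorial : ℝ))) *
          τ ^ (2 * k + 2 * j + 1) /
        ((2 : ℝ) ^ (k + j) * Real.Gamma ((k : ℝ) + ν + 3 / 2) *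
          Real.Gamma ((j : ℝ) + ν + 1)) = outerCoeff τ ν k * innerCoeff τ ν j := by
    rw [outerCoeff, innerCoeff, div_mul_div_comm]
    congr 1 <;> ring
  rw [h, Complex.ofReal_mul]
  ring

theorem outerCoeff_mul_div {τ ν : ℝ} (hτ : τ ≠ 0) (hν : -(1 / 2) < ν) (k : ℕ) :
    outerCoeff τ ν k * ((2 * k + 1 + 2 * ν) / τ) = boundaryCoeff τ ν k := by
  have h0 : (0 : ℝ) < k + ν + 1 / 2 := by have := k.cast_nonneg (α := ℝ); linarith
  have hG : Real.Gamma ((k : ℝ) + ν + 3 / 2) = (k + ν + 1 / 2) * Real.Gamma (k + ν + 1 / 2) := by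
    rw [← Real.Gamma_add_one h0.ne']
    congr 1
    ring
  have h1 := (Real.Gamma_pos_of_pos h0).ne'
  rw [outerCoeff, boundaryCoeff, hG]
  generalize Real.Gamma ((k : ℝ) + ν + 1 / 2) = G at h1
  rw [show (2 : ℝ) * k + 1 + 2 * ν = 2 * (k + ν + 1 / 2) by ring]
  generalize (k : ℝ) + ν + 1 / 2 = s at h0
  have := h0.ne'
  rw [pow_succ]
  field_simp

theorem outerCoeff_mul_succ (τ ν : ℝ) (k : ℕ) :
    outerCoeff τ ν k * (τ * (2 * k + 2)) = boundaryCoeff τ ν (k + 1) := by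
  rw [outerCoeff, boundaryCoeff, show ((k + 1 : ℕ) : ℝ) + ν + 1 / 2 = k + ν + 3 / 2 by
    push_cast; ring, Nat.factorial_succ]
  generalize Real.Gamma ((k : ℝ) + ν + 3 / 2) = G
  rcases eq_or_ne G 0 with rfl | hG
  · simp
  · push_cast
    field_simp
    ring

theorem boundaryCoeff_mul_innerCoeff (τ : ℝ) {ν : ℝ} (hν : -(1 / 2) < ν) (k : ℕ) :
    boundaryCoeff τ ν k * innerCoeff τ ν k =
      (2 : ℝ) ^ (2 * ν + 1) / Real.sqrt Real.pi *
        (((2 * k).factorial : ℝ) * τ ^ (4 * k) / Real.Gamma (2 * (k : ℝ) + 2 * ν + 1)) := by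
  have hk := k.cast_nonneg (α := ℝ)
  have hd := Real.Gamma_mul_Gamma_add_half ((k : ℝ) + ν + 1 / 2)
  rw [show (k : ℝ) + ν + 1 / 2 + 1 / 2 = k + ν + 1 by ring,
    show 2 * ((k : ℝ) + ν + 1 / 2) = 2 * k + 2 * ν + 1 by ring,
    show 1 - (2 * (k : ℝ) + 2 * ν + 1) = 1 - ((2 * ν + 1) + (2 * k : ℕ)) by push_cast; ring,
    Real.rpow_sub two_pos, Real.rpow_one, Real.rpow_add two_pos, Real.rpow_natCast] at hd
  have h1 : Real.Gamma ((k : ℝ) + ν + 1 / 2) ≠ 0 := (Real.Gamma_pos_of_pos (by linarith)).ne'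
  have h2 : Real.Gamma ((k : ℝ) + ν + 1) ≠ 0 := (Real.Gamma_pos_of_pos (by linarith)).ne'
  have h3 : Real.Gamma (2 * (k : ℝ) + 2 * ν + 1) ≠ 0 := (Real.Gamma_pos_of_pos (by linarith)).ne'
  have h4 : Real.sqrt Real.pi ≠ 0 := (Real.sqrt_pos.mpr Real.pi_pos).ne'
  have h5 : (2 : ℝ) ^ (2 * ν + 1) ≠ 0 := (Real.rpow_pos_of_pos two_pos _).ne'
  have h6 : (k.factorial : ℝ) ≠ 0 := mod_cast k.factorial_ne_zero
  rw [boundaryCoeff, innerCoeff]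
  generalize Real.Gamma ((k : ℝ) + ν + 1 / 2) = A at *
  generalize Real.Gamma ((k : ℝ) + ν + 1) = B at *
  generalize Real.Gamma (2 * (k : ℝ) + 2 * ν + 1) = G at *
  generalize (2 : ℝ) ^ (2 * ν + 1) = P at *
  generalize Real.sqrt Real.pi = S at *
  generalize ((2 * k).factorial : ℝ) = F at *
  generalize (k.factorial : ℝ) = f at *
  have e1 : τ ^ (4 * k) = (τ ^ k) ^ 4 := by ring
  have e2 : τ ^ (2 * k) = (τ ^ k) ^ 2 := by ring
  have e3 : (2 : ℝ) ^ (2 * k) = (2 ^ k) ^ 2 := by ring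
  have h7 : (2 : ℝ) ^ k ≠ 0 := by positivity
  rw [e1, e2]
  rw [e3] at hd
  generalize (2 : ℝ) ^ k = t at *
  generalize τ ^ k = u at *
  have hd' : A * B * (P * t ^ 2) = 2 * G * S := by
    rw [hd]
    field_simp
  field_simp
  linear_combination -F * u ^ 4 * hd'

theorem diffOp_fNPoly {τ ν : ℝ} (hτ : τ ≠ 0) (hν : -(1 / 2) < ν) (N : ℕ) (z w : ℂ) :
    diffOp τ ν (fNPoly τ ν N w) z =
      ∑ k ∈ Finset.range N, ((boundaryCoeff τ ν k * innerCoeff τ ν k : ℝ) : ℂ) *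
        laguerre (2 * ν) (2 * k) (2 * z / (τ : ℂ)) * laguerre (2 * ν) (2 * k) (2 * w / (τ : ℂ))
      - (boundaryCoeff τ ν N : ℂ) * laguerre (2 * ν) (2 * N) (2 * z / (τ : ℂ)) *
        ∑ j ∈ Finset.range N, (innerCoeff τ ν j : ℂ) *
          laguerre (2 * ν) (2 * j) (2 * w / (τ : ℂ)) := by
  induction N with
  | zero => simp [fNPoly, diffOp]
  | succ N ih =>
    have hstep : fNPoly τ ν (N + 1) w = fNPoly τ ν N w -
        Polynomial.C ((outerCoeff τ ν N : ℂ) * ∑ j ∈ Finset.range (N + 1),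
          (innerCoeff τ ν j : ℂ) * laguerre (2 * ν) (2 * j) (2 * w / (τ : ℂ))) *
            scaledLaguerre τ (2 * ν) (2 * N + 1) := by
      rw [fNPoly, fNPoly, Finset.sum_range_succ]
      ring
    have h1 := congrArg Complex.ofReal (outerCoeff_mul_div hτ hν N)
    have h2 := congrArg Complex.ofReal (outerCoeff_mul_succ τ ν N)
    rw [hstep, diffOp_sub_C_mul, ih, diffOp_scaledLaguerre hτ hν, eval_scaledLaguerre,
      eval_scaledLaguerre, Finset.sum_range_succ, Finset.sum_range_succ,
      show 2 * (N + 1) = 2 * N + 2 by ring]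
    push_cast at h1 h2 ⊢
    rw [← h1, ← h2]
    ring

/-- The differential equation (3.8) satisfied by `f_N(z,w)` in its first variable. -/
theorem stmt_13 (τ ν : ℝ) (hτ : τ ∈ Set.Ioo (0 : ℝ) 1) (hν : -(1 / 2 : ℝ) < ν)
    (N : ℕ) (hN : 1 ≤ N) (z w : ℂ) :
    ((1 - (τ : ℂ) ^ 2) / 2) * z * deriv (deriv (fun z' => fN τ ν N z' w)) z
      + ((2 * (ν : ℂ) + 1) * (1 - (τ : ℂ) ^ 2) / 2 + 2 * (τ : ℂ) * z) *
          deriv (fun z' => fN τ ν N z' w) z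
      + ((τ : ℂ) * (2 * (ν : ℂ) + 1) - 2 * z) * fN τ ν N z w
    = (((2 : ℝ) ^ (2 * ν + 1) / Real.sqrt Real.pi : ℝ) : ℂ) *
        ∑ k ∈ Finset.range N,
          ((((2 * k).factorial : ℝ) * τ ^ (4 * k) /
              Real.Gamma (2 * (k : ℝ) + 2 * ν + 1) : ℝ) : ℂ) *
            laguerre (2 * ν) (2 * k) (2 * z / (τ : ℂ)) *
            laguerre (2 * ν) (2 * k) (2 * w / (τ : ℂ))
      - ((((2 : ℝ) ^ N * (N.factorial : ℝ)) * τ ^ (2 * N) /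
            ((2 : ℝ) ^ (N - 1) * Real.Gamma ((N : ℝ) + ν + 1 / 2)) : ℝ) : ℂ) *
          laguerre (2 * ν) (2 * N) (2 * z / (τ : ℂ)) *
          ∑ j ∈ Finset.range N,
            (((((2 * j).factorial : ℝ) / ((2 : ℝ) ^ j * (j.factorial : ℝ))) * τ ^ (2 * j) /
                ((2 : ℝ) ^ j * Real.Gamma ((j : ℝ) + ν + 1)) : ℝ) : ℂ) *
              laguerre (2 * ν) (2 * j) (2 * w / (τ : ℂ)) := by
  have hfun : (fun z' => fN τ ν N z' w) = fun z' => (fNPoly τ ν N w).eval z' :=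
    funext fun z' => (eval_fNPoly τ ν N z' w).symm
  have hderiv (p : Polynomial ℂ) :
      deriv (fun z' => p.eval z') = fun z' => p.derivative.eval z' :=
    funext fun _ => p.deriv
  have h := diffOp_fNPoly hτ.1.ne' hν N z w
  simp only [boundaryCoeff_mul_innerCoeff τ hν] at h
  have hb : boundaryCoeff τ ν N = (2 : ℝ) ^ N * (N.factorial : ℝ) * τ ^ (2 * N) /
      ((2 : ℝ) ^ (N - 1) * Real.Gamma ((N : ℝ) + ν + 1 / 2)) := by
    obtain ⟨M, rfl⟩ := Nat.exists_eq_add_of_le' hN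
    rw [boundaryCoeff, mul_assoc 2, pow_succ (2 : ℝ) M, Nat.add_sub_cancel, mul_comm _ (2 : ℝ),
      mul_assoc (2 : ℝ) (2 ^ M) (Real.Gamma _), mul_div_mul_left _ _ two_ne_zero]
  rw [hfun, hderiv, hderiv, ← eval_fNPoly, ← hb, Finset.mul_sum]
  refine h.trans ?_
  congr 1
  refine Finset.sum_congr rfl fun k _ => ?_
  push_cast
  ring
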